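/- arXiv:2511.20519 — 2 statements merged into one kernel-verified Lean document; each statement's English description precedes it below -/
import Mathlib

section
/- Let ε > 0 and let (d_n, k_n) be a sequence of admissible dimension pairs with d_n → ∞ and k_n/d_n → 1/2, and set r_n := 2k_n − d_n − 1. If limsup_{n→∞} d_n^{-1} r_n^{d_n/k_n} < eπ, then J(d_n, k_n, ε) → 0 as n → ∞, where J(d,k,ε) := ( ∫_{σ_{d,k} ε}^{1} x^{1−(d−1)/(k−1)} (1 − x^{2/(k−1)})^{(d−k)/2 − 1} dx ) / ( ∫_0^1 x^{1−(d−1)/(k−1)} (1 − x^{2/(k−1)})^{(d−k)/2 − 1} dx ), with the convention that the numerator's integral is over the (possibly empty) interval (min{σ_{d,k} ε, 1}, 1). -/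
open MeasureTheory Filter

/-- `σ_{d,k} > 0` defined by `σ_{d,k}² = π^{(d−k)/2} Γ((2k−d−1)/2)/Γ((k−1)/2)`. -/
noncomputable def sigmaHyp (d k : ℕ) : ℝ :=
  Real.sqrt (Real.pi ^ (((d : ℝ) - k) / 2) * Real.Gamma ((2 * (k : ℝ) - d - 1) / 2) /
    Real.Gamma (((k : ℝ) - 1) / 2))

/-- The fraction `J(d,k,ε)` of the second moment of the Lévy measure `ν_{d,k}` carried by
`{x : |x| > σ_{d,k} ε}`; the numerator is an integral over `(min(σ_{d,k} ε, 1), 1)`. -/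
noncomputable def Jfrac (d k : ℕ) (ε : ℝ) : ℝ :=
  (∫ x in Set.Ioo (min (sigmaHyp d k * ε) 1) 1,
      x ^ (1 - ((d : ℝ) - 1) / ((k : ℝ) - 1)) *
        (1 - x ^ (2 / ((k : ℝ) - 1))) ^ (((d : ℝ) - k) / 2 - 1)) /
    (∫ x in Set.Ioo (0 : ℝ) 1,
      x ^ (1 - ((d : ℝ) - 1) / ((k : ℝ) - 1)) *
        (1 - x ^ (2 / ((k : ℝ) - 1))) ^ (((d : ℝ) - k) / 2 - 1))

/-- A Stirling-type upper bound for the Gamma function. -/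
lemma Gamma_le_rpow_self_mul_exp {s : ℝ} (hs : 1 ≤ s) :
    Real.Gamma s ≤ s ^ s * Real.exp (1 - s) := by
  have hs0 : 0 < s := by linarith
  have hint : ∫ x in Set.Ioi (0 : ℝ), Real.exp (-s⁻¹ * x) = s := by
    rw [integral_exp_mul_Ioi (by simpa using hs0)]
    simp
  have hpow : s ^ s * Real.exp (1 - s) = s ^ (s - 1) * Real.exp (1 - s) * s := by
    rw [Real.rpow_sub_one hs0.ne']
    field_simp
  have hrhs : s ^ (s - 1) * Real.exp (1 - s) * s =
      ∫ x in Set.Ioi (0 : ℝ), s ^ (s - 1) * Real.exp (1 - s) * Real.exp (-s⁻¹ * x) := by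
    rw [integral_const_mul, hint]
  rw [Real.Gamma_eq_integral hs0, hpow, hrhs]
  refine setIntegral_mono_on ?_ ?_ measurableSet_Ioi fun x hx => ?_
  · exact Real.GammaIntegral_convergent hs0
  · exact (integrableOn_exp_mul_Ioi (by simpa using hs0) 0).const_mul _
  · have hx0 : 0 < x := hx
    rw [Real.rpow_def_of_pos hx0, Real.rpow_def_of_pos hs0, ← Real.exp_add, ← Real.exp_add,
      ← Real.exp_add, Real.exp_le_exp]
    have hlog : Real.log x - Real.log s ≤ x / s - 1 := by
      rw [← Real.log_div hx0.ne' hs0.ne']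
      exact Real.log_le_sub_one_of_pos (by positivity)
    have hmul := mul_le_mul_of_nonneg_right hlog (sub_nonneg.2 hs)
    have hxs : x / s * s = x := by field_simp
    have hinv : s⁻¹ * x = x / s := by field_simp
    rw [neg_mul, hinv]
    nlinarith

lemma exists_pos_le_Gamma : ∃ c : ℝ, 0 < c ∧ ∀ a : ℝ, 0 < a → c ≤ Real.Gamma a := by
  obtain ⟨x, hx, hmin⟩ := Real.exists_isMinOn_Gamma_Ioi
  exact ⟨Real.Gamma x, Real.Gamma_pos_of_pos (by linarith [hx.1]), fun a ha => hmin ha⟩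

lemma integral_rpow_mul_one_sub_rpow {a b : ℝ} (ha : 0 < a) (hb : 0 < b) :
    ∫ u in Set.Ioo (0 : ℝ) 1, u ^ (a - 1) * (1 - u) ^ (b - 1) = ProbabilityTheory.beta a b := by
  rw [ProbabilityTheory.beta_eq_betaIntegralReal a b ha hb, Complex.betaIntegral,
    intervalIntegral.integral_of_le zero_le_one, ← integral_Ioc_eq_integral_Ioo,
    ← RCLike.re_to_complex, ← integral_re]
  · refine setIntegral_congr_fun measurableSet_Ioc fun x hx => ?_
    have hx0 := hx.1
    have hx1 := hx.2
    norm_cast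
    rw [← Complex.ofReal_cpow, ← Complex.ofReal_cpow, RCLike.re_to_complex,
      Complex.re_mul_ofReal, Complex.ofReal_re]
    all_goals linarith
  · have h := Complex.betaIntegral_convergent (u := a) (v := b) (by simpa) (by simpa)
    rwa [intervalIntegrable_iff_integrableOn_Ioc_of_le zero_le_one, IntegrableOn] at h

lemma integrableOn_rpow_mul_one_sub_rpow {a b : ℝ} (ha : 0 < a) (hb : 0 < b) :
    IntegrableOn (fun u : ℝ => u ^ (a - 1) * (1 - u) ^ (b - 1)) (Set.Ioo 0 1) := by
  by_contra h
  have h0 := integral_rpow_mul_one_sub_rpow ha hb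
  rw [integral_undef h] at h0
  exact (ProbabilityTheory.beta_pos ha hb).ne h0

lemma beta_add_one_left {a b : ℝ} (ha : 0 < a) (hb : 0 < b) :
    ProbabilityTheory.beta (a + 1) b = a / (a + b) * ProbabilityTheory.beta a b := by
  have hab : a + b ≠ 0 := by positivity
  have hG : Real.Gamma (a + b) ≠ 0 := (Real.Gamma_pos_of_pos (by positivity)).ne'
  rw [ProbabilityTheory.beta, ProbabilityTheory.beta, add_right_comm, Real.Gamma_add_one ha.ne',
    Real.Gamma_add_one hab]
  field_simp

/-- The centred second moment of the beta density is at most `a / (a + b) ^ 2` times its mass. -/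
lemma integral_sub_sq_mul_rpow_le {a b : ℝ} (ha : 0 < a) (hb : 0 < b) :
    IntegrableOn (fun u : ℝ => (u - a / (a + b)) ^ 2 * (u ^ (a - 1) * (1 - u) ^ (b - 1)))
      (Set.Ioo 0 1) ∧
    ∫ u in Set.Ioo (0 : ℝ) 1, (u - a / (a + b)) ^ 2 * (u ^ (a - 1) * (1 - u) ^ (b - 1)) ≤
      a / (a + b) ^ 2 * ProbabilityTheory.beta a b := by
  set m := a / (a + b) with hm
  have hexp : Set.EqOn
      (fun u : ℝ => (u - m) ^ 2 * (u ^ (a - 1) * (1 - u) ^ (b - 1)))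
      (fun u : ℝ => u ^ (a + 1 + 1 - 1) * (1 - u) ^ (b - 1)
        - 2 * m * (u ^ (a + 1 - 1) * (1 - u) ^ (b - 1))
        + m ^ 2 * (u ^ (a - 1) * (1 - u) ^ (b - 1))) (Set.Ioo 0 1) := by
    intro u hu
    have hu0 : u ≠ 0 := hu.1.ne'
    have h1 : u ^ (a + 1 - 1) = u * u ^ (a - 1) := by
      rw [add_sub_cancel_right, Real.rpow_sub_one hu0]
      field_simp
    have h2 : u ^ (a + 1 + 1 - 1) = u ^ 2 * u ^ (a - 1) := by
      rw [add_sub_cancel_right, Real.rpow_add_one hu0, Real.rpow_sub_one hu0]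
      field_simp
    simp only [h1, h2]
    ring
  have i0 := integrableOn_rpow_mul_one_sub_rpow ha hb
  have i1 := integrableOn_rpow_mul_one_sub_rpow (add_pos ha one_pos) hb
  have i2 := integrableOn_rpow_mul_one_sub_rpow (add_pos (add_pos ha one_pos) one_pos) hb
  have i21 : IntegrableOn (fun u : ℝ => u ^ (a + 1 + 1 - 1) * (1 - u) ^ (b - 1)
      - 2 * m * (u ^ (a + 1 - 1) * (1 - u) ^ (b - 1))) (Set.Ioo 0 1) :=
    i2.sub (i1.const_mul (2 * m))
  refine ⟨(i21.add (i0.const_mul (m ^ 2))).congr_fun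
    hexp.symm measurableSet_Ioo, ?_⟩
  rw [setIntegral_congr_fun measurableSet_Ioo hexp,
    integral_add i21 (i0.const_mul (m ^ 2)),
    integral_sub i2 (i1.const_mul (2 * m)), integral_const_mul, integral_const_mul,
    integral_rpow_mul_one_sub_rpow ha hb, integral_rpow_mul_one_sub_rpow (by positivity) hb,
    integral_rpow_mul_one_sub_rpow (by positivity) hb, beta_add_one_left (by positivity) hb,
    beta_add_one_left ha hb]
  have hB := ProbabilityTheory.beta_pos ha hb
  set B := ProbabilityTheory.beta a b
  have key : (a + 1) / (a + 1 + b) * (a / (a + b)) - 2 * m * (a / (a + b)) + m ^ 2 ≤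
      a / (a + b) ^ 2 := by
    have : a / (a + b) ^ 2 - ((a + 1) / (a + 1 + b) * (a / (a + b)) - 2 * m * (a / (a + b)) + m ^ 2)
        = a * (a + 1) / ((a + b) ^ 2 * (a + 1 + b)) := by
      rw [hm]
      field_simp
      ring
    have hnn : 0 ≤ a * (a + 1) / ((a + b) ^ 2 * (a + 1 + b)) := by positivity
    linarith
  nlinarith [mul_le_mul_of_nonneg_right key hB.le]

/-- Chebyshev's inequality for the upper tail of the beta density. -/
lemma integral_Ioo_rpow_mul_one_sub_rpow_le {a b t : ℝ} (ha : 0 < a) (hb : 0 < b)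
    (ht : a / (a + b) < t) :
    ∫ u in Set.Ioo t 1, u ^ (a - 1) * (1 - u) ^ (b - 1) ≤
      a / ((a + b) ^ 2 * (t - a / (a + b)) ^ 2) * ProbabilityTheory.beta a b := by
  obtain ⟨hi, hle⟩ := integral_sub_sq_mul_rpow_le ha hb
  set m := a / (a + b) with hm
  have hm0 : 0 < m := by positivity
  have hδ : 0 < (t - m) ^ 2 := by have := sub_pos.2 ht; positivity
  have hsub : Set.Ioo t 1 ⊆ Set.Ioo (0 : ℝ) 1 := Set.Ioo_subset_Ioo_left (hm0.trans ht).le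
  have hnn : ∀ u ∈ Set.Ioo (0 : ℝ) 1, 0 ≤ u ^ (a - 1) * (1 - u) ^ (b - 1) := fun u hu =>
    mul_nonneg (Real.rpow_nonneg hu.1.le _) (Real.rpow_nonneg (sub_nonneg.2 hu.2.le) _)
  have h1 : (t - m) ^ 2 * ∫ u in Set.Ioo t 1, u ^ (a - 1) * (1 - u) ^ (b - 1) ≤
      ∫ u in Set.Ioo t 1, (u - m) ^ 2 * (u ^ (a - 1) * (1 - u) ^ (b - 1)) := by
    rw [← integral_const_mul]
    refine setIntegral_mono_on
      (((integrableOn_rpow_mul_one_sub_rpow ha hb).mono_set hsub).const_mul _)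
      (hi.mono_set hsub) measurableSet_Ioo fun u hu => ?_
    refine mul_le_mul_of_nonneg_right ?_ (hnn u (hsub hu))
    exact pow_le_pow_left₀ (sub_pos.2 ht).le (by linarith [hu.1]) 2
  have h2 := setIntegral_mono_set hi
    ((ae_restrict_iff' measurableSet_Ioo).2 (Eventually.of_forall fun u hu =>
      mul_nonneg (sq_nonneg (u - m)) (hnn u hu))) (LE.le.eventuallyLE hsub)
  have h3 := h1.trans (h2.trans hle)
  rw [mul_comm, ← le_div_iff₀ hδ] at h3
  refine h3.trans_eq ?_
  field_simp

/-- The substitution `u = x ^ p` turning the Lévy density into a beta density. -/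
lemma integral_Ioo_comp_rpow {p a b e c : ℝ} (hp : 0 < p) (he : e = p * a - 1) (hc : 0 ≤ c) :
    ∫ x in Set.Ioo c 1, x ^ e * (1 - x ^ p) ^ (b - 1) =
      p⁻¹ * ∫ u in Set.Ioo (c ^ p) 1, u ^ (a - 1) * (1 - u) ^ (b - 1) := by
  have hcp : 0 ≤ c ^ p := Real.rpow_nonneg hc p
  have hsub : ∀ y : ℝ, 0 ≤ y → Set.Ioo y 1 ∩ Set.Ioi 0 = Set.Ioo y 1 := fun y hy =>
    Set.inter_eq_left.2 fun x hx => hy.trans_lt hx.1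
  have key := integral_comp_rpow_Ioi_of_pos
    (g := (Set.Ioo (c ^ p) 1).indicator fun u : ℝ => u ^ (a - 1) * (1 - u) ^ (b - 1)) hp
  rw [setIntegral_indicator measurableSet_Ioo, Set.inter_comm, hsub _ hcp] at key
  rw [← key, ← integral_const_mul, ← hsub c hc, Set.inter_comm,
    ← setIntegral_indicator measurableSet_Ioo]
  refine setIntegral_congr_fun measurableSet_Ioi fun x hx => ?_
  have hx0 : 0 < x := hx
  have hmem : x ^ p ∈ Set.Ioo (c ^ p) 1 ↔ x ∈ Set.Ioo c 1 := by
    rw [Set.mem_Ioo, Set.mem_Ioo, Real.rpow_lt_rpow_iff hc hx0.le hp,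
      Real.rpow_lt_one_iff_of_pos hx0]
    constructor
    · rintro ⟨h1, h2 | h2⟩
      · linarith [h2.2]
      · exact ⟨h1, h2.1⟩
    · rintro ⟨h1, h2⟩
      exact ⟨h1, Or.inr ⟨h2, hp⟩⟩
  by_cases h : x ∈ Set.Ioo c 1
  · simp only [Set.indicator_of_mem h, Set.indicator_of_mem (hmem.2 h), smul_eq_mul]
    have hpow : x ^ e = x ^ (p - 1) * (x ^ p) ^ (a - 1) := by
      rw [← Real.rpow_mul hx0.le, ← Real.rpow_add hx0, he]
      congr 1
      ring
    rw [hpow]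
    field_simp
  · simp only [Set.indicator_of_notMem h, Set.indicator_of_notMem (mt hmem.1 h), smul_zero,
      mul_zero]

lemma Jfrac_nonneg (d : ℕ) {k : ℕ} (hk : 1 ≤ k) {ε : ℝ} (hε : 0 ≤ ε) : 0 ≤ Jfrac d k ε := by
  have hk1 : (1 : ℝ) ≤ k := by exact_mod_cast hk
  have hnn : ∀ c : ℝ, 0 ≤ c → 0 ≤ ∫ x in Set.Ioo c 1, x ^ (1 - ((d : ℝ) - 1) / ((k : ℝ) - 1)) *
      (1 - x ^ (2 / ((k : ℝ) - 1))) ^ (((d : ℝ) - k) / 2 - 1) := by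
    intro c hc
    refine setIntegral_nonneg measurableSet_Ioo fun x hx => ?_
    have hx0 : 0 ≤ x := hc.trans hx.1.le
    exact mul_nonneg (Real.rpow_nonneg hx0 _) (Real.rpow_nonneg (sub_nonneg.2
      (Real.rpow_le_one hx0 hx.2.le (div_nonneg zero_le_two (sub_nonneg.2 hk1)))) _)
  exact div_nonneg (hnn _ (le_min (mul_nonneg (Real.sqrt_nonneg _) hε) zero_le_one)) (hnn 0 le_rfl)

lemma Jfrac_le {d k : ℕ} (hkd : k + 1 ≤ d) (hdk : d + 1 < 2 * k) {ε : ℝ} (hε : 0 < ε)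
    (ht : (2 * (k : ℝ) - d - 1) / (k - 1) < (sigmaHyp d k * ε) ^ (2 / ((k : ℝ) - 1))) :
    Jfrac d k ε ≤ (2 * (k : ℝ) - d - 1) / 2 / ((((k : ℝ) - 1) / 2) ^ 2 *
      ((sigmaHyp d k * ε) ^ (2 / ((k : ℝ) - 1)) - (2 * (k : ℝ) - d - 1) / (k - 1)) ^ 2) := by
  have hkd' : (k : ℝ) + 1 ≤ d := by exact_mod_cast hkd
  have hdk' : (d : ℝ) + 1 < 2 * k := by exact_mod_cast hdk
  have ha : 0 < (2 * (k : ℝ) - d - 1) / 2 := by linarith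
  have hb : 0 < ((d : ℝ) - k) / 2 := by linarith
  have hk : 0 < (k : ℝ) - 1 := by linarith
  have hp : 0 < 2 / ((k : ℝ) - 1) := by positivity
  have hσε : 0 ≤ sigmaHyp d k * ε := mul_nonneg (Real.sqrt_nonneg _) hε.le
  have he : 1 - ((d : ℝ) - 1) / ((k : ℝ) - 1) =
      2 / ((k : ℝ) - 1) * ((2 * (k : ℝ) - d - 1) / 2) - 1 := by
    field_simp
    ring
  have hsum : (2 * (k : ℝ) - d - 1) / 2 + ((d : ℝ) - k) / 2 = (k - 1) / 2 := by ring
  have hm : (2 * (k : ℝ) - d - 1) / 2 / ((k - 1) / 2) = (2 * (k : ℝ) - d - 1) / (k - 1) := by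
    field_simp
  rcases le_or_gt 1 (sigmaHyp d k * ε) with h | h
  · have h0 : Jfrac d k ε = 0 := by simp [Jfrac, min_eq_right h]
    rw [h0]
    positivity
  · rw [Jfrac, min_eq_left h.le, integral_Ioo_comp_rpow hp he hσε,
      integral_Ioo_comp_rpow hp he le_rfl, Real.zero_rpow hp.ne',
      integral_rpow_mul_one_sub_rpow ha hb, mul_div_mul_left _ _ (inv_ne_zero hp.ne'),
      div_le_iff₀ (ProbabilityTheory.beta_pos ha hb)]
    have hcheb := integral_Ioo_rpow_mul_one_sub_rpow_le (t := (sigmaHyp d k * ε) ^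
      (2 / ((k : ℝ) - 1))) ha hb (by rwa [hsum, hm])
    rwa [hsum, hm] at hcheb

lemma le_sq_threshold_mul {d k : ℕ} (hkd : k + 1 ≤ d) (hdk : d + 1 < 2 * k) {ε c : ℝ}
    (hε : 0 < ε) (hc : 0 < c) (hΓ : ∀ a : ℝ, 0 < a → c ≤ Real.Gamma a) :
    Real.exp 1 * (Real.pi ^ (((d : ℝ) - k) / (k - 1)) *
        (c * ε ^ 2 / Real.exp 1) ^ (2 / ((k : ℝ) - 1))) ≤
      ((sigmaHyp d k * ε) ^ (2 / ((k : ℝ) - 1))) ^ 2 * (((k : ℝ) - 1) / 2) := by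
  have hk3 : (3 : ℝ) ≤ k := by exact_mod_cast (by omega : 3 ≤ k)
  have hdk' : (d : ℝ) + 1 < 2 * k := by exact_mod_cast hdk
  have ha : 0 < (2 * (k : ℝ) - d - 1) / 2 := by linarith
  set s := ((k : ℝ) - 1) / 2 with hs
  have hs1 : 1 ≤ s := by rw [hs]; linarith
  have hs0 : 0 < s := by linarith
  have hk1 : (k : ℝ) - 1 = 2 * s := by rw [hs]; ring
  have hp : 2 / ((k : ℝ) - 1) = s⁻¹ := by rw [hk1]; field_simp
  have hG := Real.Gamma_pos_of_pos hs0
  have hGa := Real.Gamma_pos_of_pos ha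
  have hpi := Real.pi_pos
  have hσ0 : 0 ≤ sigmaHyp d k * ε := mul_nonneg (Real.sqrt_nonneg _) hε.le
  have hσ : Real.pi ^ (((d : ℝ) - k) / 2) * (c * ε ^ 2 / Real.exp 1) * ((Real.exp 1 / s) ^ s) ≤
      (sigmaHyp d k * ε) ^ 2 := by
    rw [mul_pow, sigmaHyp, Real.sq_sqrt (by positivity), ← hs, Real.div_rpow (by positivity) hs0.le,
      Real.exp_one_rpow]
    have hexp : Real.pi ^ (((d : ℝ) - k) / 2) * (c * ε ^ 2 / Real.exp 1) *
        (Real.exp s / s ^ s) =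
        Real.pi ^ (((d : ℝ) - k) / 2) * c / (s ^ s * Real.exp (1 - s)) * ε ^ 2 := by
      rw [Real.exp_sub]
      field_simp
    rw [hexp]
    gcongr
    · exact hΓ _ ha
    · exact Gamma_le_rpow_self_mul_exp hs1
  have hsq : ((sigmaHyp d k * ε) ^ s⁻¹) ^ 2 = ((sigmaHyp d k * ε) ^ 2) ^ s⁻¹ := by
    rw [← Real.rpow_mul_natCast hσ0, ← Real.rpow_natCast_mul hσ0, mul_comm s⁻¹]
  have hroot := Real.rpow_le_rpow (by positivity) hσ (inv_nonneg.2 hs0.le)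
  rw [Real.mul_rpow (by positivity) (by positivity), Real.mul_rpow (by positivity) (by positivity),
    ← Real.rpow_mul hpi.le, Real.rpow_rpow_inv (by positivity) hs0.ne'] at hroot
  have hexpo : ((d : ℝ) - k) / 2 * s⁻¹ = ((d : ℝ) - k) / (k - 1) := by
    rw [hk1]
    field_simp
  rw [hexpo] at hroot
  rw [hp, hsq]
  refine le_trans (le_of_eq ?_) (mul_le_mul_of_nonneg_right hroot hs0.le)
  field_simp

/-- If `r ^ q ≤ C * D` with `q ≥ 3 / 2` and `r ≥ 1`, then `(r + 1) * log r` is sublinear in `D`. -/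
lemma add_one_mul_log_le {r q C D : ℝ} (hr : 1 ≤ r) (hq : 3 / 2 ≤ q) (h : r ^ q ≤ C * D) :
    (r + 1) * Real.log r ≤ 8 * (C * D) ^ (5 / 6 : ℝ) := by
  have hr0 : 0 < r := by linarith
  have h32 : r ^ (3 / 2 : ℝ) ≤ C * D := (Real.rpow_le_rpow_of_exponent_le hr hq).trans h
  have hlog : Real.log r ≤ 4 * r ^ (1 / 4 : ℝ) := by
    have := Real.log_le_rpow_div hr0.le (show (0 : ℝ) < 1 / 4 by norm_num)
    linarith
  have h54 : r * r ^ (1 / 4 : ℝ) = (r ^ (3 / 2 : ℝ)) ^ (5 / 6 : ℝ) := by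
    rw [← Real.rpow_mul hr0.le, ← Real.rpow_one_add' hr0.le (by norm_num)]
    norm_num
  have hle := Real.rpow_le_rpow (by positivity) h32 (show (0 : ℝ) ≤ 5 / 6 by norm_num)
  have hnn : 0 ≤ Real.log r := Real.log_nonneg hr
  nlinarith [mul_le_mul_of_nonneg_left hlog hr0.le]

lemma tendsto_rpow_add_one_div {r D K : ℕ → ℝ} {C : ℝ} (hr : ∀ n, 1 ≤ r n)
    (hD : Tendsto D atTop atTop) (hDK : ∀ n, D n ≤ 2 * K n)
    (hratio : Tendsto (fun n => D n / K n) atTop (nhds 2))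
    (hbound : ∀ᶠ n in atTop, r n ^ (D n / K n) ≤ C * D n) :
    Tendsto (fun n => r n ^ ((r n + 1) / K n)) atTop (nhds 1) := by
  have hlim : Tendsto (fun n => 16 * C ^ (5 / 6 : ℝ) * D n ^ (-(1 / 6) : ℝ)) atTop (nhds 0) := by
    simpa using ((tendsto_rpow_neg_atTop (show (0 : ℝ) < 1 / 6 by norm_num)).comp hD).const_mul
      (16 * C ^ (5 / 6 : ℝ))
  have hzero : Tendsto (fun n => Real.log (r n) * ((r n + 1) / K n)) atTop (nhds 0) := by
    refine squeeze_zero' ?_ ?_ hlim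
    · filter_upwards [hD.eventually_gt_atTop 0] with n hn
      have hK : 0 < K n := by linarith [hDK n]
      have := hr n
      exact mul_nonneg (Real.log_nonneg this) (div_nonneg (by linarith) hK.le)
    · filter_upwards [hD.eventually_gt_atTop 0, hbound,
        hratio.eventually_const_le (show (3 / 2 : ℝ) < 2 by norm_num)] with n hn hb hq
      have hK : 0 < K n := by linarith [hDK n]
      have hC : 0 ≤ C := by
        have : 0 ≤ C * D n := le_trans (Real.rpow_nonneg (by linarith [hr n]) _) hb
        exact nonneg_of_mul_nonneg_left this hn
      have hmain := add_one_mul_log_le (hr n) hq hb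
      rw [Real.mul_rpow hC hn.le] at hmain
      have hpow : D n ^ (-(1 / 6) : ℝ) * D n = D n ^ (5 / 6 : ℝ) := by
        rw [← Real.rpow_add_one hn.ne']
        norm_num
      have hnn : 0 ≤ C ^ (5 / 6 : ℝ) * D n ^ (-(1 / 6) : ℝ) := by positivity
      rw [← mul_div_assoc, div_le_iff₀ hK]
      rw [← hpow] at hmain
      nlinarith [mul_le_mul_of_nonneg_left (hDK n) hnn]
  have hexp := (Real.continuous_exp.tendsto 0).comp hzero
  rw [Real.exp_zero] at hexp
  exact hexp.congr fun n => (Real.rpow_def_of_pos (by linarith [hr n]) _).symm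

/-- If `m * √s` and `t * √s` are separated by `√c₁ < √c₂`, then `m < t` and Chebyshev's bound is
at most `m / (√c₂ - √c₁) ^ 2`. -/
lemma chebyshev_bound_le {t m s c₁ c₂ : ℝ} (ht : 0 ≤ t) (hm : 0 ≤ m) (hs : 0 < s) (hc₁ : 0 ≤ c₁)
    (hc : c₁ < c₂) (h₁ : m ^ 2 * s ≤ c₁) (h₂ : c₂ ≤ t ^ 2 * s) :
    m < t ∧ m * s / (s ^ 2 * (t - m) ^ 2) ≤ m / (√c₂ - √c₁) ^ 2 := by
  have hsm : m * √s ≤ √c₁ := by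
    rw [← Real.sqrt_sq hm, ← Real.sqrt_mul (sq_nonneg m)]
    exact Real.sqrt_le_sqrt h₁
  have hst : √c₂ ≤ t * √s := by
    rw [← Real.sqrt_sq ht, ← Real.sqrt_mul (sq_nonneg t)]
    exact Real.sqrt_le_sqrt h₂
  have hlt : √c₁ < √c₂ := Real.sqrt_lt_sqrt hc₁ hc
  have hs0 : 0 < √s := Real.sqrt_pos.2 hs
  have hmt : m < t := lt_of_mul_lt_mul_right (hsm.trans_lt (hlt.trans_le hst)) hs0.le
  refine ⟨hmt, ?_⟩
  have hgap : (√c₂ - √c₁) ^ 2 ≤ s * (t - m) ^ 2 := by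
    calc (√c₂ - √c₁) ^ 2 ≤ (t * √s - m * √s) ^ 2 :=
          pow_le_pow_left₀ (sub_pos.2 hlt).le (by linarith) 2
      _ = √s ^ 2 * (t - m) ^ 2 := by ring
      _ = s * (t - m) ^ 2 := by rw [Real.sq_sqrt hs.le]
  have hrw : m * s / (s ^ 2 * (t - m) ^ 2) = m / (s * (t - m) ^ 2) := by
    have := (sub_pos.2 hmt).ne'
    field_simp
  rw [hrw]
  exact div_le_div_of_nonneg_left hm (pow_pos (sub_pos.2 hlt) 2) hgap

/-- If `(d_n,k_n)` is admissible, `d_n → ∞`, `k_n/d_n → 1/2` and, with `r_n = 2k_n−d_n−1`,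
`limsup d_n⁻¹ r_n^{d_n/k_n} < eπ`, then `J(d_n,k_n,ε) → 0` for every `ε > 0`. -/
theorem Jfrac_tendsto_zero (ε : ℝ) (hε : 0 < ε) (d k : ℕ → ℕ)
    (hadm : ∀ n, 1 ≤ k n ∧ k n + 1 ≤ d n ∧ d n + 1 < 2 * k n)
    (hd : Tendsto d atTop atTop)
    (hratio : Tendsto (fun n => (k n : ℝ) / (d n : ℝ)) atTop (nhds (1 / 2)))
    (hsup : Filter.limsup
        (fun n => (((d n : ℝ))⁻¹ *
          (2 * (k n : ℝ) - (d n : ℝ) - 1) ^ ((d n : ℝ) / (k n : ℝ)) : ℝ) : ℕ → EReal)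
        atTop < ((Real.exp 1 * Real.pi : ℝ) : EReal)) :
    Tendsto (fun n => Jfrac (d n) (k n) ε) atTop (nhds 0) := by
  obtain ⟨γ, hγ, hΓ⟩ := exists_pos_le_Gamma
  set D : ℕ → ℝ := fun n => d n with hDdef
  set K : ℕ → ℝ := fun n => k n with hKdef
  have hDK : ∀ n, D n + 1 < 2 * K n := fun n => by
    simp only [hDdef, hKdef]
    exact_mod_cast (hadm n).2.2
  have hKD : ∀ n, K n + 1 ≤ D n := fun n => by
    simp only [hDdef, hKdef]
    exact_mod_cast (hadm n).2.1
  have hr : ∀ n, 1 ≤ 2 * K n - D n - 1 := fun n => by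
    have h : D n + 2 ≤ 2 * K n := by
      simp only [hDdef, hKdef]
      exact_mod_cast (hadm n).2.2
    linarith
  have hDtop : Tendsto D atTop atTop := tendsto_natCast_atTop_atTop.comp hd
  have hD0 : ∀ n, D n ≠ 0 := fun n => by linarith [hKD n, hDK n]
  have hK1 : ∀ n, 0 < K n - 1 := fun n => by linarith [hKD n, hDK n]
  have hKtop : Tendsto (fun n => K n - 1) atTop atTop := by
    refine tendsto_atTop_mono (fun n => ?_) (tendsto_atTop_add_const_right atTop (-1)
      (hDtop.atTop_div_const zero_lt_two))
    linarith [hDK n]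
  have hinvD : Tendsto (fun n => (D n)⁻¹) atTop (nhds 0) := tendsto_inv_atTop_zero.comp hDtop
  have hratio' : Tendsto (fun n => K n / D n) atTop (nhds (1 / 2)) := hratio
  have hDdivK : Tendsto (fun n => D n / K n) atTop (nhds 2) := by
    simpa using hratio'.inv₀ (by norm_num)
  have hden : Tendsto (fun n => K n / D n - (D n)⁻¹) atTop (nhds (1 / 2)) := by
    simpa using hratio'.sub hinvD
  have hbs : Tendsto (fun n => (D n - K n) / (K n - 1)) atTop (nhds 1) := by
    have h := (hratio'.const_sub 1).div hden (by norm_num)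
    norm_num at h
    refine h.congr fun n => ?_
    have := hD0 n
    have := (hK1 n).ne'
    simp only [Pi.div_apply]
    field_simp
  have hDs : Tendsto (fun n => D n / (2 * (K n - 1))) atTop (nhds 1) := by
    have h := (hden.const_mul 2).inv₀ (by norm_num)
    norm_num at h
    refine h.congr fun n => ?_
    have := hD0 n
    have := (hK1 n).ne'
    field_simp
  have hmean : Tendsto (fun n => (2 * K n - D n - 1) / (K n - 1)) atTop (nhds 0) := by
    have h := (((hratio'.const_mul 2).sub_const 1).sub hinvD).div hden (by norm_num)
    norm_num at h
    refine h.congr fun n => ?_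
    have := hD0 n
    have := (hK1 n).ne'
    simp only [Pi.div_apply]
    field_simp
  obtain ⟨c', hc', hc'π⟩ := exists_between hsup
  obtain ⟨c, hcc, hcπ⟩ : ∃ c : ℝ, (∀ᶠ n in atTop,
      (D n)⁻¹ * (2 * K n - D n - 1) ^ (D n / K n) < c) ∧ c < Real.exp 1 * Real.pi := by
    have hev := eventually_lt_of_limsup_lt hc'
    obtain ⟨c, hcc, hcπ⟩ := EReal.lt_iff_exists_real_btwn.1 hc'π
    exact ⟨c, hev.mono fun n hn => EReal.coe_lt_coe_iff.1 (hn.trans hcc),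
      EReal.coe_lt_coe_iff.1 hcπ⟩
  have hpow := tendsto_rpow_add_one_div (r := fun n => 2 * K n - D n - 1) (C := c) hr hDtop
    (fun n => by linarith [hDK n]) hDdivK (hcc.mono fun n hn => by
      have hDn : 0 < D n := by linarith [hKD n, hDK n]
      rw [inv_mul_lt_iff₀ hDn, mul_comm (D n)] at hn
      exact hn.le)
  obtain ⟨c₂, hcc₂, hc₂π⟩ := exists_between hcπ
  obtain ⟨c₁, hcc₁, hc₁c₂⟩ := exists_between hcc₂
  have hc0 : 0 ≤ c := by
    obtain ⟨n, hn⟩ := hcc.exists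
    have h1 := hr n
    have hDn : 0 < D n := by linarith [hKD n, hDK n]
    have : 0 ≤ (D n)⁻¹ * (2 * K n - D n - 1) ^ (D n / K n) :=
      mul_nonneg (inv_nonneg.2 hDn.le) (Real.rpow_nonneg (by linarith) _)
    linarith
  have hupper : ∀ᶠ n in atTop,
      ((2 * K n - D n - 1) / (K n - 1)) ^ 2 * ((K n - 1) / 2) ≤ c₁ := by
    have hlim := (hDs.mul hpow).const_mul c
    rw [mul_one, mul_one] at hlim
    filter_upwards [hlim.eventually_le_const hcc₁, hcc] with n h1 h2
    refine le_trans ?_ h1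
    have hrn := hr n
    have hk1 := hK1 n
    have hDn : 0 < D n := by linarith [hKD n, hDK n]
    have hKn : 0 < K n := by linarith
    have hr0 : 0 < 2 * K n - D n - 1 := by linarith
    have hsq : (2 * K n - D n - 1) ^ 2 = (2 * K n - D n - 1) ^ (D n / K n) *
        (2 * K n - D n - 1) ^ ((2 * K n - D n - 1 + 1) / K n) := by
      rw [← Real.rpow_add hr0, ← Real.rpow_natCast]
      congr 1
      field_simp
      push_cast
      ring
    have hQ := Real.rpow_pos_of_pos hr0 ((2 * K n - D n - 1 + 1) / K n)
    calc ((2 * K n - D n - 1) / (K n - 1)) ^ 2 * ((K n - 1) / 2)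
        = (2 * K n - D n - 1) ^ 2 / (2 * (K n - 1)) := by field_simp
      _ = (D n)⁻¹ * (2 * K n - D n - 1) ^ (D n / K n) * (D n / (2 * (K n - 1)) *
          (2 * K n - D n - 1) ^ ((2 * K n - D n - 1 + 1) / K n)) := by
        rw [hsq]
        field_simp
      _ ≤ c * (D n / (2 * (K n - 1)) *
          (2 * K n - D n - 1) ^ ((2 * K n - D n - 1 + 1) / K n)) :=
        mul_le_mul_of_nonneg_right h2.le (by positivity)
  have hlower : ∀ᶠ n in atTop,
      c₂ ≤ ((sigmaHyp (d n) (k n) * ε) ^ (2 / (K n - 1))) ^ 2 * ((K n - 1) / 2) := by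
    have hlim : Tendsto (fun n => Real.exp 1 * (Real.pi ^ ((D n - K n) / (K n - 1)) *
        (γ * ε ^ 2 / Real.exp 1) ^ (2 / (K n - 1)))) atTop (nhds (Real.exp 1 * Real.pi)) := by
      have h1 := (tendsto_const_nhds (x := Real.pi)).rpow hbs (Or.inl Real.pi_ne_zero)
      have h2 := (tendsto_const_nhds (x := γ * ε ^ 2 / Real.exp 1)).rpow
        (hKtop.const_div_atTop 2) (Or.inl (by positivity))
      simpa using (h1.mul h2).const_mul (Real.exp 1)
    filter_upwards [hlim.eventually_const_le hc₂π] with n hn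
    exact hn.trans (le_sq_threshold_mul (hadm n).2.1 (hadm n).2.2 hε hγ hΓ)
  refine squeeze_zero' (Eventually.of_forall fun n => Jfrac_nonneg _ (hadm n).1 hε.le) ?_
    (by simpa using hmean.div_const ((√c₂ - √c₁) ^ 2))
  filter_upwards [hupper, hlower] with n h1 h2
  have hrn := hr n
  have hk1 := hK1 n
  obtain ⟨hlt, hle⟩ := chebyshev_bound_le
    (Real.rpow_nonneg (mul_nonneg (Real.sqrt_nonneg _) hε.le) _)
    (div_nonneg (by linarith) hk1.le) (by positivity) (hc0.trans hcc₁.le) hc₁c₂ h1 h2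
  have hms : (2 * K n - D n - 1) / (K n - 1) * ((K n - 1) / 2) = (2 * K n - D n - 1) / 2 := by
    field_simp
  rw [hms] at hle
  exact (Jfrac_le (hadm n).2.1 (hadm n).2.2 hε hlt).trans hle
end

section
/- Let ε > 0 and let (d_n, k_n) be a sequence of admissible dimension pairs with d_n → ∞ and k_n/d_n → 1/2, and set r_n := 2k_n − d_n − 1. If liminf_{n→∞} d_n^{-1} r_n^{d_n/k_n} > eπ, then J(d_n, k_n, ε) → 1 as n → ∞, where J(d,k,ε) := ( ∫_{σ_{d,k} ε}^{1} x^{1−(d−1)/(k−1)} (1 − x^{2/(k−1)})^{(d−k)/2 − 1} dx ) / ( ∫_0^1 x^{1−(d−1)/(k−1)} (1 − x^{2/(k−1)})^{(d−k)/2 − 1} dx ), with the convention that the numerator's integral is over the (possibly empty) interval (min{σ_{d,k} ε, 1}, 1). -/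
open MeasureTheory Filter

open ProbabilityTheory in
/-- The recurrence of the Beta function in its first argument. -/
lemma beta_eq_mul_beta_add_one {a b : ℝ} (ha : 0 < a) (hb : 0 < b) :
    beta a b = (a + b) / a * beta (a + 1) b := by
  have h1 : Real.Gamma (a + 1) = a * Real.Gamma a := Real.Gamma_add_one ha.ne'
  have h2 : Real.Gamma (a + 1 + b) = (a + b) * Real.Gamma (a + b) := by
    rw [add_right_comm]; exact Real.Gamma_add_one (by positivity)
  have h3 : Real.Gamma (a + b) ≠ 0 := (Real.Gamma_pos_of_pos (by positivity)).ne'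
  have h4 : a + b ≠ 0 := by positivity
  simp only [beta, h1, h2]
  field_simp

open ProbabilityTheory in
/-- A bound for the negative moment of order `s` of the Beta distribution. -/
lemma beta_sub_natCast_le {a b : ℝ} (hb : 0 < b) (s : ℕ) (ha : (s : ℝ) < a) :
    beta (a - s) b ≤ ((a + b) / (a - s)) ^ s * beta a b := by
  induction s with
  | zero => simp
  | succ s ih =>
    push_cast at ha ⊢
    have hpos : 0 < a - (s + 1) := by linarith
    have ha0 : 0 < a := lt_of_le_of_lt (by positivity) ha
    have hB : 0 < beta a b := beta_pos ha0 hb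
    have hle : (a + b) / (a - s) ≤ (a + b) / (a - (s + 1)) := by gcongr; linarith
    have h0 : 0 ≤ (a + b) / (a - s) := div_nonneg (by positivity) (by linarith)
    rw [beta_eq_mul_beta_add_one hpos hb, show a - (s + 1) + 1 = a - s by ring, pow_succ',
      mul_assoc]
    have hle' : (a - (s + 1) + b) / (a - (s + 1)) ≤ (a + b) / (a - (s + 1)) := by
      have : (0 : ℝ) ≤ s := by positivity
      gcongr
      linarith
    refine mul_le_mul hle' ((ih (by linarith)).trans ?_) (beta_pos (by linarith) hb).le
      (div_nonneg (by positivity) hpos.le)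
    gcongr

lemma rpow_mul_exp_neg_le_Gamma_add_one {x : ℝ} (hx : 0 ≤ x) :
    x ^ x * Real.exp (-x) ≤ Real.Gamma (x + 1) := by
  have hint : IntegrableOn (fun t : ℝ => Real.exp (-t) * t ^ (x + 1 - 1)) (Set.Ioi 0) :=
    Real.GammaIntegral_convergent (by linarith)
  rw [Real.Gamma_eq_integral (by linarith), ← integral_exp_neg_Ioi, ← integral_const_mul]
  calc ∫ t in Set.Ioi x, x ^ x * Real.exp (-t)
      ≤ ∫ t in Set.Ioi x, Real.exp (-t) * t ^ (x + 1 - 1) := by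
        refine setIntegral_mono_on ((integrableOn_exp_neg_Ioi x).const_mul _)
          (hint.mono_set (Set.Ioi_subset_Ioi hx)) measurableSet_Ioi fun t ht => ?_
        rw [mul_comm, add_sub_cancel_right]
        have : x ≤ t := le_of_lt ht
        gcongr
    _ ≤ ∫ t in Set.Ioi 0, Real.exp (-t) * t ^ (x + 1 - 1) := by
        refine setIntegral_mono_set hint ?_ (Set.Ioi_subset_Ioi hx).eventuallyLE
        filter_upwards [ae_restrict_mem measurableSet_Ioi] with t ht
        have : 0 < t := ht
        simp only [Pi.zero_apply]
        positivity

lemma Gamma_add_one_le_rpow_mul_exp_neg {x : ℝ} (hx : 0 ≤ x) :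
    Real.Gamma (x + 1) ≤ (x + 1) ^ (x + 1) * Real.exp (-x) := by
  have hint : IntegrableOn (fun t : ℝ => Real.exp (-t) * t ^ (x + 1 - 1)) (Set.Ioi 0) :=
    Real.GammaIntegral_convergent (by linarith)
  have hx1 : 0 < x + 1 := by linarith
  have hneg : -(1 / (x + 1)) < 0 := by simpa using hx1
  rw [Real.Gamma_eq_integral hx1]
  calc ∫ t in Set.Ioi 0, Real.exp (-t) * t ^ (x + 1 - 1)
      ≤ ∫ t in Set.Ioi 0, ((x + 1) ^ x * Real.exp (-x)) * Real.exp (-(1 / (x + 1)) * t) := by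
        refine setIntegral_mono_on hint ((integrableOn_exp_mul_Ioi hneg 0).const_mul _)
          measurableSet_Ioi fun t ht => ?_
        have ht : 0 < t := ht
        have h1 : t / (x + 1) ≤ Real.exp (t / (x + 1) - 1) := by
          linarith [Real.add_one_le_exp (t / (x + 1) - 1)]
        have h2 : (t / (x + 1)) ^ x ≤ Real.exp (t / (x + 1) - 1) ^ x := by gcongr
        rw [← Real.exp_mul, Real.div_rpow ht.le hx1.le, div_le_iff₀ (by positivity)] at h2
        rw [add_sub_cancel_right]
        calc Real.exp (-t) * t ^ x
            ≤ Real.exp (-t) * (Real.exp ((t / (x + 1) - 1) * x) * (x + 1) ^ x) := by gcongr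
          _ = (x + 1) ^ x * (Real.exp (-t) * Real.exp ((t / (x + 1) - 1) * x)) := by ring
          _ = (x + 1) ^ x * (Real.exp (-x) * Real.exp (-(1 / (x + 1)) * t)) := by
              rw [← Real.exp_add, ← Real.exp_add]
              congr 2
              field_simp
              ring
          _ = _ := by ring
    _ = (x + 1) ^ (x + 1) * Real.exp (-x) := by
        rw [integral_const_mul, integral_exp_mul_Ioi hneg, Real.rpow_add_one hx1.ne']
        simp only [mul_zero, Real.exp_zero]
        field_simp

lemma le_log_Gamma {x : ℝ} (hx : 0 < x) :
    (x - 1) * Real.log x - x ≤ Real.log (Real.Gamma x) := by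
  have hG := Real.Gamma_pos_of_pos hx
  have h := Real.log_le_log (by positivity) (rpow_mul_exp_neg_le_Gamma_add_one hx.le)
  rw [Real.Gamma_add_one hx.ne', Real.log_mul (by positivity) (by positivity),
    Real.log_mul hx.ne' hG.ne', Real.log_rpow hx, Real.log_exp] at h
  linarith

lemma log_Gamma_le {x : ℝ} (hx : 1 ≤ x) :
    Real.log (Real.Gamma x) ≤ x * Real.log x - x + 2 := by
  have hx0 : 0 < x := by linarith
  have hG := Real.Gamma_pos_of_pos hx0
  have h := Real.log_le_log (Real.Gamma_pos_of_pos (by linarith))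
    (Gamma_add_one_le_rpow_mul_exp_neg hx0.le)
  rw [Real.Gamma_add_one hx0.ne', Real.log_mul hx0.ne' hG.ne',
    Real.log_mul (by positivity) (by positivity), Real.log_rpow (by linarith), Real.log_exp] at h
  have h1 : Real.log (x + 1) ≤ Real.log x + 1 / x := by
    have := Real.log_le_sub_one_of_pos (show 0 < (x + 1) / x by positivity)
    rw [Real.log_div (by positivity) hx0.ne', add_div, div_self hx0.ne'] at this
    linarith
  have h2 : (x + 1) * Real.log (x + 1) ≤ (x + 1) * (Real.log x + 1 / x) := by gcongr
  have h3 : (x + 1) * (1 / x) ≤ 2 := by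
    rw [mul_one_div, div_le_iff₀ hx0]; linarith
  linarith

open ProbabilityTheory in
lemma betaPDFReal_nonneg {a b : ℝ} (ha : 0 < a) (hb : 0 < b) (x : ℝ) :
    0 ≤ betaPDFReal a b x := by
  by_cases hx : 0 < x ∧ x < 1
  · exact (betaPDFReal_pos hx.1 hx.2 ha hb).le
  · simp [betaPDFReal, hx]

open ProbabilityTheory in
lemma integrable_betaPDFReal {a b : ℝ} (ha : 0 < a) (hb : 0 < b) :
    Integrable (betaPDFReal a b) := by
  rw [← lintegral_ofReal_ne_top_iff_integrable (by fun_prop) (ae_of_all _ (betaPDFReal_nonneg ha hb))]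
  exact (lintegral_betaPDF_eq_one ha hb).trans_ne ENNReal.one_ne_top

open ProbabilityTheory in
lemma integral_betaPDFReal {a b : ℝ} (ha : 0 < a) (hb : 0 < b) :
    ∫ x, betaPDFReal a b x = 1 := by
  rw [integral_eq_lintegral_of_nonneg_ae (ae_of_all _ (betaPDFReal_nonneg ha hb)) (by fun_prop)]
  exact (congrArg ENNReal.toReal (lintegral_betaPDF_eq_one ha hb)).trans ENNReal.toReal_one

/-- The density, up to normalization, of the `m`-th power of a Beta-distributed variable. -/
noncomputable def betaPowKernel (a b m x : ℝ) : ℝ :=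
  x ^ (a / m - 1) * (1 - x ^ (1 / m)) ^ (b - 1)

open ProbabilityTheory in
lemma betaPDFReal_comp_rpow_eq_indicator {a b m : ℝ} (hm : 0 < m) {x : ℝ} (hx : 0 < x) :
    (1 / m * x ^ (1 / m - 1)) • betaPDFReal a b (x ^ (1 / m)) =
      (Set.Ioo 0 1).indicator (fun y => 1 / (m * beta a b) * betaPowKernel a b m y) x := by
  have hiff : x ^ (1 / m) < 1 ↔ x < 1 := Real.rpow_lt_one_iff_of_pos hx |>.trans <| by
    have : 0 < 1 / m := by positivity
    constructor
    · rintro (h | h)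
      · linarith
      · exact h.1
    · exact fun h => Or.inr ⟨h, this⟩
  by_cases h1 : x < 1
  · have hu : 0 < x ^ (1 / m) := Real.rpow_pos_of_pos hx _
    rw [Set.indicator_of_mem (show x ∈ Set.Ioo (0 : ℝ) 1 from ⟨hx, h1⟩), betaPDFReal,
      if_pos ⟨hu, hiff.2 h1⟩, betaPowKernel, ← Real.rpow_mul hx.le,
      show a / m - 1 = (1 / m - 1) + 1 / m * (a - 1) by ring, Real.rpow_add hx, smul_eq_mul,
      one_div_mul_eq_div, one_div_mul_eq_div, ← div_div]
    ring
  · rw [Set.indicator_of_notMem (fun h => h1 h.2), betaPDFReal,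
      if_neg (fun h => h1 (hiff.1 h.2)), smul_zero]

open ProbabilityTheory in
lemma integrableOn_betaPowKernel {a b m : ℝ} (ha : 0 < a) (hb : 0 < b) (hm : 0 < m) :
    IntegrableOn (betaPowKernel a b m) (Set.Ioo 0 1) := by
  have hB := beta_pos ha hb
  have h := (integrableOn_Ioi_comp_rpow_iff (betaPDFReal a b) (p := 1 / m) (by positivity)).2
    (integrable_betaPDFReal ha hb).integrableOn
  rw [abs_of_pos (by positivity : (0 : ℝ) < 1 / m), integrableOn_congr_fun
    (fun x (hx : x ∈ Set.Ioi 0) => betaPDFReal_comp_rpow_eq_indicator hm hx) measurableSet_Ioi,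
    IntegrableOn, integrable_indicator_iff measurableSet_Ioo, IntegrableOn,
    Measure.restrict_restrict measurableSet_Ioo,
    Set.inter_eq_left.2 (fun x hx => hx.1)] at h
  exact (integrable_const_mul_iff (by simp [hm.ne', hB.ne']) _).1 h

open ProbabilityTheory in
lemma integral_betaPowKernel {a b m : ℝ} (ha : 0 < a) (hb : 0 < b) (hm : 0 < m) :
    ∫ x in Set.Ioo 0 1, betaPowKernel a b m x = m * beta a b := by
  have hB := beta_pos ha hb
  have h := integral_comp_rpow_Ioi_of_pos (g := betaPDFReal a b) (p := 1 / m) (by positivity)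
  have h1 : ∫ x in Set.Ioi 0, betaPDFReal a b x = 1 := by
    rw [← integral_betaPDFReal ha hb]
    refine setIntegral_eq_integral_of_forall_compl_eq_zero fun x hx => ?_
    exact if_neg fun h => hx h.1
  rw [h1, setIntegral_congr_fun measurableSet_Ioi
    (fun x hx => betaPDFReal_comp_rpow_eq_indicator hm hx),
    setIntegral_indicator measurableSet_Ioo,
    Set.inter_eq_right.2 (fun x hx => hx.1), integral_const_mul] at h
  field_simp at h
  exact h

open ProbabilityTheory in
/-- The mass of a power of a Beta variable on `(c, 1)`, bounded below with a moment of order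
`-s`. -/
lemma betaPowKernel_ratio_mem_Icc {a b c : ℝ} (s : ℕ) (ha : (s : ℝ) < a) (hb : 0 < b)
    (hc : 0 < c) :
    (∫ x in Set.Ioo (min c 1) 1, betaPowKernel a b (a + b) x) /
        (∫ x in Set.Ioo 0 1, betaPowKernel a b (a + b) x) ∈
      Set.Icc (1 - (c ^ (1 / (a + b)) * (a + b) / (a - s)) ^ s) 1 := by
  have has : 0 < a - s := by linarith
  have ha0 : 0 < a := lt_of_le_of_lt (by positivity) ha
  have hm : 0 < a + b := by positivity
  have hB := beta_pos ha0 hb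
  set m := a + b with hm_def
  set δ := c ^ (1 / m) with hδ
  have hI := integral_betaPowKernel ha0 hb hm
  have hf := integrableOn_betaPowKernel ha0 hb hm
  have hK := integrableOn_betaPowKernel has hb hm
  have hnn : ∀ a', ∀ x ∈ Set.Ioo (0 : ℝ) 1, 0 ≤ betaPowKernel a' b m x := fun a' x hx => by
    have : x ^ (1 / m) ≤ 1 := Real.rpow_le_one hx.1.le hx.2.le (by positivity)
    exact mul_nonneg (Real.rpow_nonneg hx.1.le _) (Real.rpow_nonneg (by linarith) _)
  have hpos : 0 < m * beta a b := by positivity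
  have hmin : 0 ≤ min c 1 := le_min hc.le zero_le_one
  rw [hI, Set.mem_Icc, div_le_one hpos, le_div_iff₀ hpos]
  constructor
  · have hpt : ∀ x ∈ Set.Ioo (0 : ℝ) 1,
        betaPowKernel a b m x - δ ^ s * betaPowKernel (a - s) b m x ≤
          (Set.Ioi (min c 1)).indicator (betaPowKernel a b m) x := fun x hx => by
      have hKx := hnn (a - s) x hx
      by_cases hxc : min c 1 < x
      · rw [Set.indicator_of_mem (show x ∈ Set.Ioi (min c 1) from hxc)]
        have : 0 ≤ δ ^ s * betaPowKernel (a - s) b m x := by positivity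
        linarith
      · rw [Set.indicator_of_notMem (show x ∉ Set.Ioi (min c 1) from hxc), sub_nonpos]
        have hxc' : x ≤ c := (not_lt.1 hxc).trans (min_le_left _ _)
        have hle : (x ^ (1 / m)) ^ s ≤ δ ^ s := by
          have := hx.1.le
          rw [hδ]
          gcongr
        calc betaPowKernel a b m x = (x ^ (1 / m)) ^ s * betaPowKernel (a - s) b m x := by
              rw [betaPowKernel, betaPowKernel, ← mul_assoc, ← Real.rpow_natCast,
                ← Real.rpow_mul hx.1.le, ← Real.rpow_add hx.1]
              congr 2
              ring
          _ ≤ _ := by gcongr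
    have h := setIntegral_mono_on (hf.sub (hK.const_mul (δ ^ s)))
      (hf.indicator measurableSet_Ioi) measurableSet_Ioo hpt
    simp only [Pi.sub_apply] at h
    rw [integral_sub hf (hK.const_mul _), integral_const_mul, hI, integral_betaPowKernel has hb hm,
      setIntegral_indicator measurableSet_Ioi, Set.inter_comm, Set.Ioi_inter_Ioo,
      sup_eq_left.2 hmin] at h
    have h2 := beta_sub_natCast_le hb s ha
    have h3 : δ ^ s * (m * beta (a - s) b) ≤ δ ^ s * (m * ((m / (a - s)) ^ s * beta a b)) := by
      gcongr
    calc (1 - (δ * m / (a - s)) ^ s) * (m * beta a b)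
        = m * beta a b - δ ^ s * (m * ((m / (a - s)) ^ s * beta a b)) := by
          rw [mul_div_assoc, mul_pow]; ring
      _ ≤ _ := by linarith
  · rw [← hI]
    refine setIntegral_mono_set hf ?_ (Set.Ioo_subset_Ioo_left hmin).eventuallyLE
    filter_upwards [ae_restrict_mem measurableSet_Ioo] with x hx using hnn a x hx

lemma sigmaHyp_pos {d k : ℕ} (h : k + 1 ≤ d ∧ d + 1 < 2 * k) : 0 < sigmaHyp d k := by
  have h2 : (d : ℝ) + 1 < 2 * k := by exact_mod_cast h.2
  have h3 : (1 : ℝ) < k := by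
    have : 1 < k := by omega
    exact_mod_cast this
  have := Real.Gamma_pos_of_pos (show 0 < (2 * (k : ℝ) - d - 1) / 2 by linarith)
  have := Real.Gamma_pos_of_pos (show 0 < ((k : ℝ) - 1) / 2 by linarith)
  have := Real.pi_pos
  unfold sigmaHyp
  positivity

lemma Jfrac_mem_Icc {d k : ℕ} {ε : ℝ} (hε : 0 < ε) (h : k + 1 ≤ d ∧ d + 1 < 2 * k) (s : ℕ)
    (hs : (s : ℝ) < (2 * (k : ℝ) - d - 1) / 2) :
    Jfrac d k ε ∈ Set.Icc (1 - ((sigmaHyp d k * ε) ^ (1 / (((k : ℝ) - 1) / 2)) *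
      (((k : ℝ) - 1) / 2) / ((2 * (k : ℝ) - d - 1) / 2 - s)) ^ s) 1 := by
  have h1 : (k : ℝ) + 1 ≤ d := by exact_mod_cast h.1
  have hk : (k : ℝ) - 1 ≠ 0 := by
    have : 1 < k := by omega
    exact sub_ne_zero.2 (by exact_mod_cast this.ne')
  have := betaPowKernel_ratio_mem_Icc s hs (show 0 < ((d : ℝ) - k) / 2 by linarith)
    (mul_pos (sigmaHyp_pos h) hε)
  rw [show (2 * (k : ℝ) - d - 1) / 2 + ((d : ℝ) - k) / 2 = ((k : ℝ) - 1) / 2 by ring] at this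
  convert this using 1
  simp only [Jfrac, betaPowKernel, one_div_div]
  rw [show (2 * (k : ℝ) - d - 1) / 2 / (((k : ℝ) - 1) / 2) - 1 = 1 - ((d : ℝ) - 1) / (k - 1) by
    field_simp; ring]

lemma log_sigmaHyp_sq_le {d k : ℕ} (h : k + 1 ≤ d ∧ d + 3 ≤ 2 * k) {m a : ℝ}
    (hm : m = ((k : ℝ) - 1) / 2) (ha : a = (2 * (k : ℝ) - d - 1) / 2) :
    2 * Real.log (sigmaHyp d k) ≤
      (m - a) * Real.log Real.pi + (a * Real.log a - a + 2) - ((m - 1) * Real.log m - m) := by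
  have h2 : (d : ℝ) + 3 ≤ 2 * k := by exact_mod_cast h.2
  have h1 : (k : ℝ) + 1 ≤ d := by exact_mod_cast h.1
  have ha1 : 1 ≤ a := by rw [ha]; linarith
  have hm0 : 0 < m := by rw [hm]; linarith
  have hGa := Real.Gamma_pos_of_pos (show 0 < a by linarith)
  have hGm := Real.Gamma_pos_of_pos hm0
  have hpi := Real.pi_pos
  have hσ : sigmaHyp d k = √(Real.pi ^ (m - a) * Real.Gamma a / Real.Gamma m) := by
    rw [sigmaHyp, ← hm, ← ha, show ((d : ℝ) - k) / 2 = m - a by rw [hm, ha]; ring]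
  rw [hσ, Real.log_sqrt (by positivity), Real.log_div (by positivity) hGm.ne',
    Real.log_mul (by positivity) hGa.ne', Real.log_rpow hpi]
  linarith [le_log_Gamma hm0, log_Gamma_le ha1]

/-- The exponents `r / (k - 1)` and `2 - d / k` differ by a nonpositive amount, so the Stirling
main term is controlled by `d⁻¹ r ^ (d / k)`. -/
lemma log_sub_mul_log_le {d k : ℕ} (h : k + 1 ≤ d ∧ d + 3 ≤ 2 * k) {m a : ℝ}
    (hm : m = ((k : ℝ) - 1) / 2) (ha : a = (2 * (k : ℝ) - d - 1) / 2) :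
    Real.log m - (2 - a / m) * Real.log a ≤
      Real.log (2 * (k / d : ℝ)) -
        Real.log ((d : ℝ)⁻¹ * (2 * (k : ℝ) - d - 1) ^ ((d : ℝ) / k)) := by
  have h2 : (d : ℝ) + 3 ≤ 2 * k := by exact_mod_cast h.2
  have h1 : (k : ℝ) + 1 ≤ d := by exact_mod_cast h.1
  have hk : (4 : ℝ) ≤ k := by linarith
  have hd : (0 : ℝ) < d := by linarith
  set r : ℝ := 2 * (k : ℝ) - d - 1 with hr
  have hr2 : 2 ≤ r := by rw [hr]; linarith
  have hk1 : (0 : ℝ) < k - 1 := by linarith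
  have hratio : a / m = r / (k - 1) := by rw [ha, hm]; field_simp
  have hlogm : Real.log m ≤ Real.log k - Real.log 2 := by
    rw [hm, Real.log_div hk1.ne' two_ne_zero]
    have := Real.log_le_log hk1 (sub_le_self (k : ℝ) zero_le_one)
    linarith
  have hloga : Real.log a = Real.log r - Real.log 2 := by
    rw [ha, Real.log_div (by positivity) two_ne_zero]
  have hexp : (d : ℝ) / k - 2 + r / (k - 1) ≤ 0 := by
    have : (d : ℝ) / k - 2 + r / (k - 1) = (k - d) / (k * (k - 1)) := by
      rw [hr]; field_simp; ring
    rw [this]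
    exact div_nonpos_of_nonpos_of_nonneg (by linarith) (by positivity)
  have hlogr : 0 ≤ Real.log r := Real.log_nonneg (by linarith)
  have hlog2 : 0 ≤ Real.log 2 := Real.log_nonneg one_le_two
  have hq : 0 ≤ r / (k - 1) := by positivity
  rw [Real.log_mul two_ne_zero (by positivity), Real.log_div (by positivity) hd.ne',
    Real.log_mul (by positivity) (by positivity), Real.log_inv, Real.log_rpow (by positivity),
    hratio, hloga]
  nlinarith [mul_nonpos_of_nonpos_of_nonneg hexp hlogr, mul_nonneg hq hlog2]

lemma rpow_sigmaHyp_mul_le {d k : ℕ} {ε c : ℝ} (hε : 0 < ε) (hc : 0 < c)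
    (h : k + 1 ≤ d ∧ d + 3 ≤ 2 * k)
    (hcr : c ≤ (d : ℝ)⁻¹ * (2 * (k : ℝ) - d - 1) ^ ((d : ℝ) / k)) {m a : ℝ}
    (hm : m = ((k : ℝ) - 1) / 2) (ha : a = (2 * (k : ℝ) - d - 1) / 2) :
    (sigmaHyp d k * ε) ^ (1 / m) * m ≤
      a * Real.exp ((Real.log Real.pi + 1 - Real.log c + Real.log (2 * (k / d : ℝ)) +
        ((2 * Real.log ε + 2) * m⁻¹ + Real.log m / m)) / 2) := by
  have h2 : (d : ℝ) + 3 ≤ 2 * k := by exact_mod_cast h.2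
  have h1 : (k : ℝ) + 1 ≤ d := by exact_mod_cast h.1
  have ha1 : 1 ≤ a := by rw [ha]; linarith
  have ha0 : 0 < a := by linarith
  have hm0 : 0 < m := by rw [hm]; linarith
  have hσ := sigmaHyp_pos (d := d) (k := k) ⟨h.1, by omega⟩
  have hσε : 0 < sigmaHyp d k * ε := by positivity
  rw [← Real.log_le_log_iff (by positivity) (by positivity), Real.log_mul (by positivity) hm0.ne',
    Real.log_mul ha0.ne' (by positivity), Real.log_exp, Real.log_rpow hσε,
    Real.log_mul hσ.ne' hε.ne']
  have hA := log_sigmaHyp_sq_le h hm ha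
  have hB := log_sub_mul_log_le h hm ha
  have hC := Real.log_le_log hc hcr
  have hpi : 0 ≤ Real.log Real.pi := Real.log_nonneg (by linarith [Real.pi_gt_three])
  have hA' : 1 / m * (2 * Real.log (sigmaHyp d k)) ≤ Real.log Real.pi + 1 - Real.log m +
      a / m * Real.log a + 2 * m⁻¹ + Real.log m / m := by
    rw [one_div_mul_eq_div, div_le_iff₀ hm0]
    calc _ ≤ _ := hA
      _ ≤ m * Real.log Real.pi + m - m * Real.log m + a * Real.log a + 2 + Real.log m := by
        nlinarith
      _ = _ := by field_simp
  have hE : 1 / m * (Real.log (sigmaHyp d k) + Real.log ε) =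
      (1 / m * (2 * Real.log (sigmaHyp d k)) + 2 * Real.log ε * m⁻¹) / 2 := by
    field_simp
  rw [hE]
  linarith

lemma tendsto_sub_atTop_of_lt_inv_mul_rpow {d k : ℕ → ℕ} {c : ℝ} (hc : 0 < c)
    (hadm : ∀ n, 1 ≤ k n ∧ k n + 1 ≤ d n ∧ d n + 1 < 2 * k n) (hd : Tendsto d atTop atTop)
    (hcr : ∀ᶠ n in atTop,
      c < (d n : ℝ)⁻¹ * (2 * (k n : ℝ) - d n - 1) ^ ((d n : ℝ) / k n)) :
    Tendsto (fun n => 2 * (k n : ℝ) - d n - 1) atTop atTop := by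
  have hd' : Tendsto (fun n => (d n : ℝ)) atTop atTop := tendsto_natCast_atTop_atTop.comp hd
  refine tendsto_atTop_mono' _ ?_ (Real.tendsto_sqrt_atTop.comp (hd'.const_mul_atTop hc))
  filter_upwards [hcr] with n hn
  obtain ⟨h1, h2, h3⟩ := hadm n
  have h1' : (1 : ℝ) ≤ k n := by exact_mod_cast h1
  have h2' : (k n : ℝ) + 1 ≤ d n := by exact_mod_cast h2
  have h3' : (d n : ℝ) + 2 ≤ 2 * k n := by exact_mod_cast h3
  have hd0 : (0 : ℝ) < d n := by linarith
  have hr : (1 : ℝ) ≤ 2 * (k n : ℝ) - d n - 1 := by linarith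
  refine Real.sqrt_le_iff.2 ⟨by linarith, ?_⟩
  have hle : (2 * (k n : ℝ) - d n - 1) ^ ((d n : ℝ) / k n) ≤
      (2 * (k n : ℝ) - d n - 1) ^ (2 : ℝ) := by
    refine Real.rpow_le_rpow_of_exponent_le hr ?_
    rw [div_le_iff₀ (by linarith)]
    linarith
  rw [Real.rpow_two] at hle
  rw [inv_mul_eq_div, lt_div_iff₀ hd0] at hn
  exact hn.le.trans hle

/-- If `(d_n,k_n)` is admissible, `d_n → ∞`, `k_n/d_n → 1/2` and, with `r_n = 2k_n−d_n−1`,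
`liminf d_n⁻¹ r_n^{d_n/k_n} > eπ`, then `J(d_n,k_n,ε) → 1` for every `ε > 0`. -/
theorem Jfrac_tendsto_one_of_liminf_gt (ε : ℝ) (hε : 0 < ε) (d k : ℕ → ℕ)
    (hadm : ∀ n, 1 ≤ k n ∧ k n + 1 ≤ d n ∧ d n + 1 < 2 * k n)
    (hd : Tendsto d atTop atTop)
    (hratio : Tendsto (fun n => (k n : ℝ) / (d n : ℝ)) atTop (nhds (1 / 2)))
    (hinf : ((Real.exp 1 * Real.pi : ℝ) : EReal) <
      Filter.liminf
        (fun n => (((d n : ℝ))⁻¹ *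
          (2 * (k n : ℝ) - (d n : ℝ) - 1) ^ ((d n : ℝ) / (k n : ℝ)) : ℝ) : ℕ → EReal)
        atTop) :
    Tendsto (fun n => Jfrac (d n) (k n) ε) atTop (nhds 1) := by
  obtain ⟨c, hc, hcl⟩ := EReal.lt_iff_exists_real_btwn.1 hinf
  have hπ := Real.pi_pos
  have hc' : Real.exp 1 * Real.pi < c := EReal.coe_lt_coe_iff.1 hc
  have hc0 : 0 < c := lt_trans (by positivity) hc'
  have hev : ∀ᶠ n in atTop,
      c < (d n : ℝ)⁻¹ * (2 * (k n : ℝ) - d n - 1) ^ ((d n : ℝ) / k n) := by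
    filter_upwards [eventually_lt_of_lt_liminf hcl] with n hn using EReal.coe_lt_coe_iff.1 hn
  have hr := tendsto_sub_atTop_of_lt_inv_mul_rpow hc0 hadm hd hev
  have hmem (s : ℕ) (n : ℕ) := Jfrac_mem_Icc (s := s) hε (hadm n).2
  set m : ℕ → ℝ := fun n => ((k n : ℝ) - 1) / 2 with hm
  set a : ℕ → ℝ := fun n => (2 * (k n : ℝ) - d n - 1) / 2 with ha
  have ha_top : Tendsto a atTop atTop := hr.atTop_div_const two_pos
  have hm_top : Tendsto m atTop atTop := tendsto_atTop_mono (fun n => by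
    have : (k n : ℝ) + 1 ≤ d n := by exact_mod_cast (hadm n).2.1
    simp only [ha, hm]
    linarith) ha_top
  set B : ℕ → ℝ := fun n => (Real.log Real.pi + 1 - Real.log c +
    Real.log (2 * (k n / d n : ℝ)) + ((2 * Real.log ε + 2) * (m n)⁻¹ +
      Real.log (m n) / m n)) / 2 with hB
  set L : ℝ := (Real.log Real.pi + 1 - Real.log c) / 2 with hL
  have hL0 : L < 0 := by
    have := Real.log_lt_log (by positivity) hc'
    rw [Real.log_mul (by positivity) hπ.ne', Real.log_exp] at this
    rw [hL]
    linarith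
  have hB_lim : Tendsto B atTop (nhds L) := by
    have h1 : Tendsto (fun n => Real.log (2 * (k n / d n : ℝ))) atTop (nhds 0) := by
      have h := (hratio.const_mul 2).log (by norm_num)
      norm_num at h
      exact h
    have h2 : Tendsto (fun n => Real.log (m n) / m n) atTop (nhds 0) :=
      Real.isLittleO_log_id_atTop.tendsto_div_nhds_zero.comp hm_top
    have h3 := (tendsto_inv_atTop_zero.comp hm_top).const_mul (2 * Real.log ε + 2)
    have h := ((h1.const_add (Real.log Real.pi + 1 - Real.log c)).add (h3.add h2)).div_const 2
    simpa [hL] using h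
  have hlower (s : ℕ) : ∀ᶠ n in atTop,
      1 - (Real.exp (B n) * (1 - s / a n)⁻¹) ^ s ≤ Jfrac (d n) (k n) ε ∧
        Jfrac (d n) (k n) ε ≤ 1 := by
    filter_upwards [hev, ha_top.eventually_gt_atTop (s : ℝ), ha_top.eventually_ge_atTop 1]
      with n hn hsn han
    obtain ⟨h1, h2⟩ := hmem s n hsn
    have hadm3 : d n + 3 ≤ 2 * k n := by
      have : (d n : ℝ) + 3 ≤ 2 * k n := by simp only [ha] at han; linarith
      exact_mod_cast this
    have hle := rpow_sigmaHyp_mul_le hε hc0 ⟨(hadm n).2.1, hadm3⟩ hn.le (m := m n) (a := a n)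
      rfl rfl
    have hpos : 0 < a n - s := by linarith
    have han0 : 0 < a n := by linarith
    have hm0 : 0 ≤ m n := by
      have : (1 : ℝ) ≤ k n := by exact_mod_cast (hadm n).1
      simp only [hm]
      linarith
    have hσ := sigmaHyp_pos (hadm n).2
    refine ⟨(sub_le_sub_left (pow_le_pow_left₀ (by positivity) ?_ s) 1).trans h1, h2⟩
    calc _ ≤ a n * Real.exp (B n) / (a n - s) := by gcongr
      _ = _ := by
        rw [one_sub_div han0.ne', inv_div]
        ring
  have hlim (s : ℕ) : Tendsto (fun n => 1 - (Real.exp (B n) * (1 - s / a n)⁻¹) ^ s) atTop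
      (nhds (1 - Real.exp L ^ s)) := by
    have h1 : Tendsto (fun n => 1 - s / a n) atTop (nhds 1) := by
      simpa using (ha_top.const_div_atTop (s : ℝ)).const_sub 1
    have h := (((Real.continuous_exp.tendsto L).comp hB_lim).mul
      (h1.inv₀ one_ne_zero)).pow s |>.const_sub 1
    simpa using h
  refine tendsto_order.2 ⟨fun u hu => ?_, fun u hu => ?_⟩
  · obtain ⟨s, hs⟩ := exists_pow_lt_of_lt_one (sub_pos.2 hu) (Real.exp_lt_one_iff.2 hL0)
    filter_upwards [hlower s, (hlim s).eventually_const_lt (by linarith : u < 1 - Real.exp L ^ s)]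
      with n h1 h2 using h2.trans_le h1.1
  · filter_upwards [hlower 0] with n h1 using h1.2.trans_lt hu
end
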